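/- Let n0 ∈ S² and let n be an exterior minimizing harmonic map on ℝ³∖B̄₁ with far-field value n0. Then for every α < 2 there exist a radius R₀ = R₀(n) ≥ 1 and a constant C = C(n, α) such that (1/R) ∫_{|x|≥R} |∇n|² ≤ C / R^α for all R ≥ R₀, i.e. ∫_{|x|≥R} |∇n|² ≤ C R^{1−α}. -/

import Mathlib

open MeasureTheory Filter Metric Real
open scoped ENNReal NNReal Topology

noncomputable section

/-- Three-dimensional Euclidean space. -/
abbrev E3 : Type := EuclideanSpace ℝ (Fin 3)

/-- The exterior `ℝ³ ∖ B̄₁` of the closed unit ball. -/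
def ExtB1 : Set E3 := {x : E3 | 1 < ‖x‖}

/-- `|∇f|²`, the squared Frobenius norm of the gradient of `f`. -/
def gradSq (f : E3 → E3) (x : E3) : ℝ :=
  ∑ i : Fin 3, ‖fderiv ℝ f x (EuclideanSpace.single i (1 : ℝ))‖ ^ 2

/-- The Dirichlet energy `∫_s |∇f|²`, valued in `[0,∞]`. -/
def eEnergy (s : Set E3) (f : E3 → E3) : ℝ≥0∞ :=
  ∫⁻ x in s, ENNReal.ofReal (gradSq f x)

/-- `f` takes values in the unit sphere `S²` on `s`. -/
def UnitValuedOn (f : E3 → E3) (s : Set E3) : Prop := ∀ x ∈ s, ‖f x‖ = 1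

/-- `f` minimizes the Dirichlet energy on `s` among all `S²`-valued maps that agree with `f`
outside a compact subset of `s`. -/
def MinimizingOn (f : E3 → E3) (s : Set E3) : Prop :=
  ∀ g : E3 → E3, UnitValuedOn g s → (∀ x ∈ s, DifferentiableAt ℝ g x) →
    (∃ K : Set E3, IsCompact K ∧ K ⊆ s ∧ ∀ x ∈ s \ K, g x = f x) →
    eEnergy s f ≤ eEnergy s g

/-- An exterior minimizing harmonic map on `ℝ³ ∖ B̄₁` with far-field value `n0 ∈ S²`. -/
def ExtMinimizer (n0 : E3) (n : E3 → E3) : Prop :=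
  UnitValuedOn n ExtB1 ∧ (∀ x ∈ ExtB1, DifferentiableAt ℝ n x) ∧
  (∫⁻ x in ExtB1, (‖n x - n0‖₊ : ℝ≥0∞) ^ 2 / (‖x‖₊ : ℝ≥0∞) ^ 2) < ⊤ ∧
  eEnergy ExtB1 n < ⊤ ∧ MinimizingOn n ExtB1

/-- The linear map `v ↦ a v + m ⟨y, v⟩ y`. -/
def radialLin (y : E3) (a m : ℝ) : E3 →L[ℝ] E3 :=
  a • ContinuousLinearMap.id ℝ E3 + (m • innerSL ℝ y).smulRight y

lemma radialLin_apply (y : E3) (a m : ℝ) (v : E3) :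
    radialLin y a m v = a • v + (m * inner ℝ y v) • y := by
  simp [radialLin]

lemma radialLin_comp (y : E3) (a m : ℝ) (ha : a ≠ 0) (hb : a + m * ‖y‖ ^ 2 ≠ 0) (v : E3) :
    radialLin y a⁻¹ (-(m / (a * (a + m * ‖y‖ ^ 2)))) (radialLin y a m v) = v := by
  simp only [radialLin_apply, inner_add_right, inner_smul_right, real_inner_self_eq_norm_sq,
    smul_add, smul_smul]
  rw [inv_mul_cancel₀ ha, one_smul, add_assoc, ← add_smul]
  convert add_zero v using 2
  convert zero_smul ℝ y using 2
  field_simp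
  ring

lemma radialLin_comp' (y : E3) (a m : ℝ) (ha : a ≠ 0) (hb : a + m * ‖y‖ ^ 2 ≠ 0) (v : E3) :
    radialLin y a m (radialLin y a⁻¹ (-(m / (a * (a + m * ‖y‖ ^ 2)))) v) = v := by
  simp only [radialLin_apply, inner_add_right, inner_smul_right, real_inner_self_eq_norm_sq,
    smul_add, smul_smul]
  rw [mul_inv_cancel₀ ha, one_smul, add_assoc, ← add_smul]
  convert add_zero v using 2
  convert zero_smul ℝ y using 2
  field_simp
  ring

/-- `radialLin y a m` as an invertible map. -/
def radialEquiv (y : E3) (a m : ℝ) (ha : a ≠ 0) (hb : a + m * ‖y‖ ^ 2 ≠ 0) : E3 ≃L[ℝ] E3 :=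
  ContinuousLinearEquiv.equivOfInverse (radialLin y a m)
    (radialLin y a⁻¹ (-(m / (a * (a + m * ‖y‖ ^ 2)))))
    (radialLin_comp y a m ha hb) (radialLin_comp' y a m ha hb)

lemma radialLin_det (y : E3) (a m : ℝ) :
    (radialLin y a m).det = a ^ 2 * (a + m * ‖y‖ ^ 2) := by
  rw [ContinuousLinearMap.det,
    ← LinearMap.det_toMatrix (EuclideanSpace.basisFun (Fin 3) ℝ).toBasis, Matrix.det_fin_three]
  simp [LinearMap.toMatrix_apply, radialLin_apply, EuclideanSpace.norm_sq_eq, Fin.sum_univ_three,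
    EuclideanSpace.inner_single_right]
  ring

/-- The squared Frobenius norm of a linear map. -/
def frobSq (L : E3 →L[ℝ] E3) : ℝ := ∑ i : Fin 3, ‖L (EuclideanSpace.single i (1 : ℝ))‖ ^ 2

lemma apply_eq_sum (L : E3 →L[ℝ] E3) (y : E3) :
    L y = ∑ i : Fin 3, y i • L (EuclideanSpace.single i (1 : ℝ)) := by
  conv_lhs => rw [← (EuclideanSpace.basisFun (Fin 3) ℝ).sum_repr y]
  simp

lemma frobSq_nonneg (L : E3 →L[ℝ] E3) : 0 ≤ frobSq L := by
  unfold frobSq; positivity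

lemma norm_sq_apply_le_frobSq (L : E3 →L[ℝ] E3) (y : E3) :
    ‖L y‖ ^ 2 ≤ ‖y‖ ^ 2 * frobSq L := by
  have h1 : ‖L y‖ ≤ ∑ i : Fin 3, |y i| * ‖L (EuclideanSpace.single i (1 : ℝ))‖ := by
    rw [apply_eq_sum L y]
    refine (norm_sum_le _ _).trans (le_of_eq ?_)
    simp [norm_smul]
  calc ‖L y‖ ^ 2 ≤ (∑ i : Fin 3, |y i| * ‖L (EuclideanSpace.single i (1 : ℝ))‖) ^ 2 := by gcongr
    _ ≤ (∑ i : Fin 3, |y i| ^ 2) * ∑ i : Fin 3, ‖L (EuclideanSpace.single i (1 : ℝ))‖ ^ 2 :=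
      Finset.sum_mul_sq_le_sq_mul_sq _ _ _
    _ = _ := by rw [EuclideanSpace.norm_sq_eq, frobSq]; simp

lemma frobSq_comp_radialLin (L : E3 →L[ℝ] E3) (y : E3) (a m : ℝ) :
    frobSq (L.comp (radialLin y a m)) =
      a ^ 2 * frobSq L + (2 * a * m + m ^ 2 * ‖y‖ ^ 2) * ‖L y‖ ^ 2 := by
  have key : ∀ i : Fin 3, ‖(L.comp (radialLin y a m)) (EuclideanSpace.single i (1 : ℝ))‖ ^ 2 =
      a ^ 2 * ‖L (EuclideanSpace.single i (1 : ℝ))‖ ^ 2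
        + 2 * a * m * inner ℝ (y i • L (EuclideanSpace.single i (1 : ℝ))) (L y)
        + m ^ 2 * (y i) ^ 2 * ‖L y‖ ^ 2 := by
    intro i
    simp only [ContinuousLinearMap.comp_apply, radialLin_apply, map_add, map_smul,
      EuclideanSpace.inner_single_right]
    rw [norm_add_sq_real, norm_smul, norm_smul, mul_pow, mul_pow, real_inner_smul_left,
      real_inner_smul_left, real_inner_smul_right]
    simp [mul_pow, sq_abs]
    ring
  have hs : ‖y‖ ^ 2 = ∑ i, y i ^ 2 := by rw [EuclideanSpace.norm_sq_eq]; simp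
  rw [frobSq, Finset.sum_congr rfl fun i _ => key i, Finset.sum_add_distrib,
    Finset.sum_add_distrib, ← Finset.mul_sum, ← Finset.mul_sum, ← Finset.sum_mul,
    ← Finset.mul_sum, ← sum_inner, ← apply_eq_sum, real_inner_self_eq_norm_sq, ← hs, ← frobSq]
  ring

lemma det_mul_frobSq_comp (L : E3 →L[ℝ] E3) (y : E3) (a m : ℝ) (ha : a ≠ 0)
    (hb : a + m * ‖y‖ ^ 2 ≠ 0) :
    a ^ 2 * (a + m * ‖y‖ ^ 2) *
      frobSq (L.comp (radialLin y a⁻¹ (-(m / (a * (a + m * ‖y‖ ^ 2)))))) =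
    (a + m * ‖y‖ ^ 2) * frobSq L -
      m * (2 * a + m * ‖y‖ ^ 2) / (a + m * ‖y‖ ^ 2) * ‖L y‖ ^ 2 := by
  rw [frobSq_comp_radialLin]
  field_simp
  ring

/-- The radial deformation `y ↦ (1 - η(|y|²)) y`. -/
def radialMap (η : ℝ → ℝ) (y : E3) : E3 := y - η (‖y‖ ^ 2) • y

lemma hasFDerivAt_radialMap {η : ℝ → ℝ} {y : E3} (hη : DifferentiableAt ℝ η (‖y‖ ^ 2)) :
    HasFDerivAt (radialMap η)
      (radialLin y (1 - η (‖y‖ ^ 2)) (-(2 * deriv η (‖y‖ ^ 2)))) y := by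
  have h1 : HasFDerivAt (fun z : E3 => ‖z‖ ^ 2) (2 • innerSL ℝ y) y :=
    (hasStrictFDerivAt_norm_sq y).hasFDerivAt
  have h2 := hη.hasDerivAt.comp_hasFDerivAt y h1
  have h3 := (hasFDerivAt_id (𝕜 := ℝ) y).sub (h2.smul (hasFDerivAt_id (𝕜 := ℝ) y))
  refine h3.congr_fderiv ?_
  ext1 v
  simp only [radialLin_apply, _root_.sub_apply, _root_.add_apply,
    _root_.smul_apply, ContinuousLinearMap.smulRight_apply, innerSL_apply_apply,
    ContinuousLinearMap.id_apply, Function.comp_apply, id]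
  simp only [smul_eq_mul, nsmul_eq_mul, sub_smul, one_smul]
  rw [sub_add_eq_sub_sub, sub_eq_add_neg (v - _), ← neg_smul]
  congr 2
  push_cast
  ring

lemma gradSq_eq (f : E3 → E3) (x : E3) : gradSq f x = frobSq (fderiv ℝ f x) := rfl

lemma isOpen_ExtB1 : IsOpen ExtB1 := isOpen_lt continuous_const continuous_norm

/-- The energy density of the deformation of `n` by `radialMap η`, pulled back. -/
def deformedDensity (n : E3 → E3) (η : ℝ → ℝ) (y : E3) : ℝ :=
  (1 - η (‖y‖ ^ 2) + -(2 * deriv η (‖y‖ ^ 2)) * ‖y‖ ^ 2) * gradSq n y -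
    -(2 * deriv η (‖y‖ ^ 2)) *
      (2 * (1 - η (‖y‖ ^ 2)) + -(2 * deriv η (‖y‖ ^ 2)) * ‖y‖ ^ 2) /
      (1 - η (‖y‖ ^ 2) + -(2 * deriv η (‖y‖ ^ 2)) * ‖y‖ ^ 2) * ‖fderiv ℝ n y y‖ ^ 2

lemma energy_le_deformed {n : E3 → E3} (hu : UnitValuedOn n ExtB1)
    (hd : ∀ x ∈ ExtB1, DifferentiableAt ℝ n x) (hmin : MinimizingOn n ExtB1)
    {η : ℝ → ℝ} {b : ℝ} {c : ℝ≥0} (hη : Differentiable ℝ η)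
    (hsupp : ∀ q, q ≤ 2 ∨ b ≤ q → η q = 0)
    (hlip : LipschitzWith c fun y : E3 => η (‖y‖ ^ 2) • y) (hc : c < 1)
    (h1 : ∀ q, 0 < 1 - η q) (h2 : ∀ q, 0 < 1 - η q + -(2 * deriv η q) * q) :
    eEnergy ExtB1 n ≤ ∫⁻ y in ExtB1, ENNReal.ofReal (deformedDensity n η y) := by
  have happ : ApproximatesLinearOn (radialMap η)
      ((ContinuousLinearEquiv.refl ℝ E3 : E3 ≃L[ℝ] E3) : E3 →L[ℝ] E3) Set.univ c := by
    refine (ApproximatesLinearOn.approximatesLinearOn_iff_lipschitzOnWith (c := c)).2 ?_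
    rw [lipschitzOnWith_univ]
    have : (radialMap η - ⇑((ContinuousLinearEquiv.refl ℝ E3 : E3 ≃L[ℝ] E3) : E3 →L[ℝ] E3)) =
        fun y : E3 => -(η (‖y‖ ^ 2) • y) := by
      ext1 y; simp [radialMap]
    rw [this]
    exact hlip.neg
  have hN : Subsingleton E3 ∨
      c < ‖((ContinuousLinearEquiv.refl ℝ E3).symm : E3 →L[ℝ] E3)‖₊⁻¹ := by
    right
    have : ‖((ContinuousLinearEquiv.refl ℝ E3).symm : E3 →L[ℝ] E3)‖₊ = 1 := by
      ext
      exact ContinuousLinearMap.norm_id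
    rw [this, inv_one]; exact hc
  let e : E3 ≃ₜ E3 := ApproximatesLinearOn.toHomeomorph (radialMap η) happ hN
  have he : ∀ y, e y = radialMap η y := fun y => rfl
  have hfix : ∀ y : E3, ‖y‖ ^ 2 ≤ 2 ∨ b ≤ ‖y‖ ^ 2 → e y = y := by
    intro y hy
    simp [he, radialMap, hsupp _ hy]
  have hfix' : ∀ y : E3, ‖y‖ ^ 2 ≤ 2 ∨ b ≤ ‖y‖ ^ 2 → e.symm y = y := by
    intro y hy
    rw [e.symm_apply_eq, hfix y hy]
  have hout : ∀ y : E3, y ∉ ExtB1 → ‖y‖ ^ 2 ≤ 2 := by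
    intro y hy
    simp only [ExtB1, Set.mem_ofPred_eq, not_lt] at hy
    nlinarith [norm_nonneg y]
  have hE : ∀ y, y ∈ ExtB1 → e y ∈ ExtB1 := by
    intro y hy
    by_contra hcon
    have := hfix _ (Or.inl (hout _ hcon))
    rw [e.injective this] at hcon
    exact hcon hy
  have hE' : ∀ y, y ∈ ExtB1 → e.symm y ∈ ExtB1 := by
    intro y hy
    by_contra hcon
    have := hfix _ (Or.inl (hout _ hcon))
    rw [e.apply_symm_apply] at this
    rw [← this] at hcon
    exact hcon hy
  let D : ∀ y : E3, E3 ≃L[ℝ] E3 := fun y =>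
    radialEquiv y (1 - η (‖y‖ ^ 2)) (-(2 * deriv η (‖y‖ ^ 2))) (h1 _).ne' (h2 _).ne'
  have hDe : ∀ y, HasFDerivAt e (D y : E3 →L[ℝ] E3) y := fun y => hasFDerivAt_radialMap (hη _)
  have hDs : ∀ y, HasFDerivAt e.symm ((D y).symm : E3 →L[ℝ] E3) (e y) := by
    intro y
    refine HasFDerivAt.of_local_left_inverse (f := e) e.symm.continuous.continuousAt ?_
      (Eventually.of_forall fun z => e.apply_symm_apply z)
    rw [e.symm_apply_apply]
    exact hDe y
  have hgD : ∀ y ∈ ExtB1, HasFDerivAt (n ∘ e.symm)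
      ((fderiv ℝ n y).comp ((D y).symm : E3 →L[ℝ] E3)) (e y) := by
    intro y hy
    refine HasFDerivAt.comp (e y) ?_ (hDs y)
    rw [e.symm_apply_apply]
    exact (hd y hy).hasFDerivAt
  have himg : e '' ExtB1 = ExtB1 := by
    ext x
    constructor
    · rintro ⟨y, hy, rfl⟩
      exact hE y hy
    · intro hx
      exact ⟨e.symm x, hE' x hx, e.apply_symm_apply x⟩
  have hle := hmin (n ∘ e.symm) (fun x hx => hu _ (hE' x hx))
    (fun x hx => by
      have := (hgD _ (hE' x hx)).differentiableAt
      rwa [e.apply_symm_apply] at this)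
    ⟨{y : E3 | 2 ≤ ‖y‖ ^ 2 ∧ ‖y‖ ^ 2 ≤ b}, by
      refine Metric.isCompact_of_isClosed_isBounded ?_ ?_
      · exact (isClosed_le continuous_const (continuous_norm.pow 2)).inter
          (isClosed_le (continuous_norm.pow 2) continuous_const)
      · refine (Metric.isBounded_closedBall (x := (0 : E3)) (r := b + 1)).subset ?_
        rintro y ⟨-, hy⟩
        rw [mem_closedBall_zero_iff]
        nlinarith [norm_nonneg y, sq_nonneg (‖y‖ - 1)], by
      rintro y ⟨hy, -⟩
      show 1 < ‖y‖
      nlinarith [norm_nonneg y], by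
      rintro y ⟨-, hy⟩
      rw [Set.mem_ofPred_eq, not_and_or, not_le, not_le] at hy
      simp [hfix' y (hy.imp le_of_lt le_of_lt)]⟩
  refine hle.trans (le_of_eq ?_)
  rw [eEnergy]
  conv_lhs => rw [← himg]
  rw [lintegral_image_eq_lintegral_abs_det_fderiv_mul volume isOpen_ExtB1.measurableSet
    (fun y _ => (hDe y).hasFDerivWithinAt) e.injective.injOn]
  refine setLIntegral_congr_fun isOpen_ExtB1.measurableSet fun y hy => ?_
  have hdet : (D y : E3 →L[ℝ] E3).det = (1 - η (‖y‖ ^ 2)) ^ 2 *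
      (1 - η (‖y‖ ^ 2) + -(2 * deriv η (‖y‖ ^ 2)) * ‖y‖ ^ 2) := radialLin_det _ _ _
  have hdet0 : 0 < (D y : E3 →L[ℝ] E3).det := by
    rw [hdet]; exact mul_pos (pow_pos (h1 _) 2) (h2 _)
  rw [abs_of_pos hdet0, ← ENNReal.ofReal_mul hdet0.le, hdet, gradSq_eq, (hgD y hy).fderiv]
  congr 1
  exact det_mul_frobSq_comp _ _ _ _ (h1 _).ne' (h2 _).ne'

lemma deformedDensity_le {n : E3 → E3} {h : ℝ → ℝ} {y : E3} {t ℓ P : ℝ}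
    (hh : DifferentiableAt ℝ h (‖y‖ ^ 2)) (hy : 1 < ‖y‖) (ht : 0 < t)
    (h2 : 1 / 2 ≤ 1 - t * (h (‖y‖ ^ 2) + 2 * ‖y‖ ^ 2 * deriv h (‖y‖ ^ 2)))
    (hP : |2 * ‖y‖ ^ 2 * deriv h (‖y‖ ^ 2)| ≤ P)
    (hsub : ℓ ≤ h (‖y‖ ^ 2) - 2 * ‖y‖ ^ 2 * deriv h (‖y‖ ^ 2))
    (hadd : ℓ ≤ h (‖y‖ ^ 2) + 2 * ‖y‖ ^ 2 * deriv h (‖y‖ ^ 2)) :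
    deformedDensity n (fun q => t * h q) y ≤ gradSq n y * (1 - t * ℓ + 2 * t ^ 2 * P ^ 2) := by
  have hq : 0 < ‖y‖ ^ 2 := by positivity
  have hA := norm_sq_apply_le_frobSq (fderiv ℝ n y) y
  rw [← gradSq_eq] at hA
  have hA0 : 0 ≤ ‖fderiv ℝ n y y‖ ^ 2 := by positivity
  rw [deformedDensity, deriv_const_mul _ hh]
  generalize ‖fderiv ℝ n y y‖ ^ 2 = S at *
  generalize ‖y‖ ^ 2 = q at *
  generalize gradSq n y = G at *
  generalize h q = k at *
  generalize deriv h q = d at *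
  obtain ⟨A, rfl⟩ : ∃ A, S = q * A := ⟨S / q, by field_simp⟩
  have hA0' : 0 ≤ A := nonneg_of_mul_nonneg_right hA0 hq
  have hA' : A ≤ G := le_of_mul_le_mul_left hA hq
  obtain ⟨p, hp⟩ : ∃ p, p = 2 * q * d := ⟨_, rfl⟩
  rw [← hp] at hsub hadd hP h2
  have hr : 0 < 1 - t * (k + p) := by linarith
  have hrew : (1 - t * k + -(2 * (t * d)) * q) * G -
      -(2 * (t * d)) * (2 * (1 - t * k) + -(2 * (t * d)) * q) /
      (1 - t * k + -(2 * (t * d)) * q) * (q * A) =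
      (1 - t * (k + p)) * (G - A) + (1 - t * (k - p)) * A +
        t ^ 2 * p ^ 2 * A / (1 - t * (k + p)) := by
    have e1 : 1 - t * k + -(2 * (t * d)) * q = 1 - t * (k + p) := by rw [hp]; ring
    rw [e1]
    field_simp
    rw [hp]
    ring
  rw [hrew]
  have hpP : p ^ 2 ≤ P ^ 2 := by
    rw [← sq_abs p]; gcongr
  have b1 : t ^ 2 * p ^ 2 * A / (1 - t * (k + p)) ≤ 2 * t ^ 2 * P ^ 2 * G := by
    rw [div_le_iff₀ hr]
    have : t ^ 2 * p ^ 2 * A ≤ t ^ 2 * P ^ 2 * G := by gcongr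
    have h0 : 0 ≤ t ^ 2 * P ^ 2 * G := by
      have : 0 ≤ G := hA0'.trans hA'
      positivity
    nlinarith
  have b2 : (1 - t * (k + p)) * (G - A) ≤ (1 - t * ℓ) * (G - A) := by
    have : 0 ≤ G - A := by linarith
    gcongr
  have b3 : (1 - t * (k - p)) * A ≤ (1 - t * ℓ) * A := by gcongr
  linarith

lemma measurable_gradSq (n : E3 → E3) : Measurable (gradSq n) := by
  unfold gradSq
  exact Finset.measurable_sum _ fun i _ =>
    ((measurable_fderiv_apply_const ℝ n _).norm).pow_const 2

lemma gradSq_nonneg (n : E3 → E3) (x : E3) : 0 ≤ gradSq n x := frobSq_nonneg _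

lemma integrableOn_gradSq {n : E3 → E3} (hfin : eEnergy ExtB1 n < ⊤) :
    IntegrableOn (gradSq n) ExtB1 := by
  refine ⟨(measurable_gradSq n).aestronglyMeasurable, ?_⟩
  rw [hasFiniteIntegral_iff_ofReal (Eventually.of_forall (gradSq_nonneg n))]
  exact hfin

/-- First variation inequality for radial deformations. -/
lemma integral_gradSq_mul_nonpos {n : E3 → E3} (hu : UnitValuedOn n ExtB1)
    (hd : ∀ x ∈ ExtB1, DifferentiableAt ℝ n x) (hfin : eEnergy ExtB1 n < ⊤)
    (hmin : MinimizingOn n ExtB1) {h : ℝ → ℝ} {b : ℝ} (hh : ContDiff ℝ 1 h)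
    (hsupp : ∀ q, q ≤ 2 ∨ b ≤ q → h q = 0) {ℓ : ℝ → ℝ} {B : ℝ} (hℓm : Measurable ℓ)
    (hℓb : ∀ q, |ℓ q| ≤ B)
    (hsub : ∀ q, 1 < q → ℓ q ≤ h q - 2 * q * deriv h q)
    (hadd : ∀ q, 1 < q → ℓ q ≤ h q + 2 * q * deriv h q) :
    ∫ y in ExtB1, gradSq n y * ℓ (‖y‖ ^ 2) ≤ 0 := by
  have hG := integrableOn_gradSq hfin
  have hhd : Differentiable ℝ h := hh.differentiable (by norm_num)
  have hcs : HasCompactSupport h := by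
    refine HasCompactSupport.intro (isCompact_Icc (a := (2 : ℝ)) (b := b)) fun q hq => ?_
    rw [Set.mem_Icc, not_and_or, not_le, not_le] at hq
    exact hsupp q (hq.imp le_of_lt le_of_lt)
  have hdc : Continuous (deriv h) := hh.continuous_deriv le_rfl
  obtain ⟨H, hH⟩ := hh.continuous.bounded_above_of_compact_support hcs
  obtain ⟨P, hP⟩ := Continuous.bounded_above_of_compact_support
    (f := fun q => 2 * q * deriv h q) (by fun_prop) (hcs.deriv.mul_left)
  have hXc : HasCompactSupport fun y : E3 => h (‖y‖ ^ 2) • y := by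
    refine HasCompactSupport.intro (isCompact_closedBall (0 : E3) (b + 1)) fun y hy => ?_
    rw [mem_closedBall_zero_iff, not_le] at hy
    rw [hsupp _ (Or.inr (by nlinarith [norm_nonneg y, sq_nonneg (‖y‖ - 1)])), zero_smul]
  have hXd : ContDiff ℝ 1 fun y : E3 => h (‖y‖ ^ 2) • y :=
    (hh.comp (contDiff_norm_sq ℝ)).smul contDiff_id
  obtain ⟨c, hc⟩ := ContDiff.lipschitzWith_of_hasCompactSupport hXc hXd one_ne_zero
  have hH0 : 0 ≤ H := (norm_nonneg _).trans (hH 0)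
  have hP0 : 0 ≤ P := (norm_nonneg _).trans (hP 0)
  set t₀ : ℝ := 1 / (2 * (1 + c + H + P)) with ht₀
  have hden : 0 < 1 + (c : ℝ) + H + P := by have := c.coe_nonneg; positivity
  have ht₀pos : 0 < t₀ := by positivity
  have hintegrable : IntegrableOn (fun y : E3 => gradSq n y * ℓ (‖y‖ ^ 2)) ExtB1 := by
    refine hG.mul_bdd (c := B) (hℓm.comp (by fun_prop)).aestronglyMeasurable
      (Eventually.of_forall fun y => hℓb _)
  have main : ∀ t, 0 < t → t ≤ t₀ →
      ∫ y in ExtB1, gradSq n y * ℓ (‖y‖ ^ 2) ≤ 2 * t * P ^ 2 * ∫ y in ExtB1, gradSq n y := by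
    intro t ht htt
    have hts : t * (1 + c + H + P) ≤ 1 / 2 := by
      calc t * (1 + c + H + P) ≤ t₀ * (1 + c + H + P) := by gcongr
        _ = 1 / 2 := by rw [ht₀]; field_simp
    have hc0 := c.coe_nonneg
    have htc : t * c ≤ 1 / 2 := by nlinarith [mul_nonneg ht.le hH0, mul_nonneg ht.le hP0]
    have htH : t * (H + P) ≤ 1 / 2 := by nlinarith [mul_nonneg ht.le hc0]
    have hb1 : ∀ q, 1 / 2 ≤ 1 - t * h q := by
      intro q
      have := (abs_le.1 (hH q)).2
      nlinarith [mul_le_mul_of_nonneg_left this ht.le, mul_nonneg ht.le hP0]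
    have hb2 : ∀ q, 1 / 2 ≤ 1 - t * (h q + 2 * q * deriv h q) := by
      intro q
      have h1 := (abs_le.1 (hH q)).2
      have h2 := (abs_le.1 (hP q)).2
      nlinarith [mul_le_mul_of_nonneg_left (add_le_add h1 h2) ht.le]
    have hle := energy_le_deformed hu hd hmin (η := fun q => t * h q) (b := b)
      (c := ‖t‖₊ * c) (hhd.const_mul t) (fun q hq => by simp [hsupp q hq])
      (by
        simpa only [Function.comp_def, smul_smul] using (lipschitzWith_smul t).comp hc)
      (by
        rw [← NNReal.coe_lt_coe]
        rw [NNReal.coe_mul, coe_nnnorm, Real.norm_of_nonneg ht.le]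
        exact lt_of_le_of_lt htc (by norm_num))
      (fun q => by linarith [hb1 q])
      (fun q => by
        rw [deriv_const_mul _ (hhd q)]
        linarith [hb2 q])
    have hbd : ∫⁻ y in ExtB1, ENNReal.ofReal (deformedDensity n (fun q => t * h q) y) ≤
        ∫⁻ y in ExtB1, ENNReal.ofReal
          (gradSq n y * (1 - t * ℓ (‖y‖ ^ 2) + 2 * t ^ 2 * P ^ 2)) := by
      refine setLIntegral_mono' isOpen_ExtB1.measurableSet fun y hy => ?_
      have hy1 : 1 < ‖y‖ := hy
      have hq1 : 1 < ‖y‖ ^ 2 := by nlinarith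
      exact ENNReal.ofReal_le_ofReal (deformedDensity_le (hhd _) hy1 ht (hb2 _) (hP _)
        (hsub _ hq1) (hadd _ hq1))
    have hnn : ∀ y ∈ ExtB1, 0 ≤ gradSq n y * (1 - t * ℓ (‖y‖ ^ 2) + 2 * t ^ 2 * P ^ 2) := by
      intro y hy
      have hy1 : 1 < ‖y‖ := hy
      have hq1 : 1 < ‖y‖ ^ 2 := by nlinarith
      refine mul_nonneg (gradSq_nonneg n y) ?_
      nlinarith [mul_le_mul_of_nonneg_left (hadd _ hq1) ht.le, hb2 (‖y‖ ^ 2),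
        mul_nonneg (sq_nonneg t) (sq_nonneg P)]
    have heq : (fun y : E3 => gradSq n y * (1 - t * ℓ (‖y‖ ^ 2) + 2 * t ^ 2 * P ^ 2)) =
        fun y => (1 + 2 * t ^ 2 * P ^ 2) * gradSq n y - t * (gradSq n y * ℓ (‖y‖ ^ 2)) := by
      ext1 y; ring
    have hintegrable_total : IntegrableOn
        (fun y : E3 => gradSq n y * (1 - t * ℓ (‖y‖ ^ 2) + 2 * t ^ 2 * P ^ 2)) ExtB1 := by
      rw [heq]
      exact (hG.const_mul _).sub (hintegrable.const_mul _)
    have hfinal := hle.trans hbd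
    rw [eEnergy, ← ofReal_integral_eq_lintegral_ofReal hG
      (Eventually.of_forall (gradSq_nonneg n)), ← ofReal_integral_eq_lintegral_ofReal hintegrable_total
      ((ae_restrict_iff' isOpen_ExtB1.measurableSet).2 (Eventually.of_forall hnn)),
      ENNReal.ofReal_le_ofReal_iff (setIntegral_nonneg isOpen_ExtB1.measurableSet hnn), heq,
      integral_sub (hG.const_mul _) (hintegrable.const_mul _), integral_const_mul,
      integral_const_mul] at hfinal
    refine le_of_mul_le_mul_left ?_ ht
    linarith
  refine ge_of_tendsto (f := fun t : ℝ => 2 * t * P ^ 2 * ∫ y in ExtB1, gradSq n y)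
    (x := 𝓝[>] 0) ?_ ?_
  · have : Tendsto (fun t : ℝ => 2 * t * P ^ 2 * ∫ y in ExtB1, gradSq n y) (𝓝 0)
        (𝓝 (2 * 0 * P ^ 2 * ∫ y in ExtB1, gradSq n y)) := by
      apply Continuous.tendsto
      fun_prop
    simp only [mul_zero, zero_mul] at this
    exact this.mono_left nhdsWithin_le_nhds
  · filter_upwards [Ioc_mem_nhdsGT ht₀pos] with t ht using main t ht.1 ht.2

lemma deriv_smoothTransition_of_nonpos {x : ℝ} (hx : x ≤ 0) :
    deriv smoothTransition x = 0 := by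
  refine IsLocalMin.deriv_eq_zero (Eventually.of_forall fun y => ?_)
  rw [smoothTransition.zero_of_nonpos hx]
  exact smoothTransition.nonneg y

lemma deriv_smoothTransition_of_one_le {x : ℝ} (hx : 1 ≤ x) :
    deriv smoothTransition x = 0 := by
  refine IsLocalMax.deriv_eq_zero (Eventually.of_forall fun y => ?_)
  rw [smoothTransition.one_of_one_le hx]
  exact smoothTransition.le_one y

lemma exists_deriv_smoothTransition_le : ∃ D : ℝ, ∀ x, deriv smoothTransition x ≤ D := by
  have hc : Continuous (deriv smoothTransition) :=
    (smoothTransition.contDiff (n := 1)).continuous_deriv le_rfl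
  obtain ⟨D, hD⟩ := hc.bounded_above_of_compact_support
    (HasCompactSupport.intro (isCompact_Icc (a := (0 : ℝ)) (b := 1)) fun x hx => by
      rw [Set.mem_Icc, not_and_or, not_le, not_le] at hx
      exact hx.elim (fun h => deriv_smoothTransition_of_nonpos h.le)
        fun h => deriv_smoothTransition_of_one_le h.le)
  exact ⟨D, fun x => (le_abs_self _).trans (hD x)⟩

/-- The profile `R √((q + 1) / (q + R²))`, comparable to `min √q R`. -/
def profile (R q : ℝ) : ℝ := R * √((q + 1) / (q + R ^ 2))

lemma profile_pos {R q : ℝ} (hR : 0 < R) (hq : 0 ≤ q) : 0 < profile R q := by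
  unfold profile; positivity

lemma profile_sq {R q : ℝ} (hR : 0 < R) (hq : 0 ≤ q) :
    profile R q ^ 2 * (q + R ^ 2) = R ^ 2 * (q + 1) := by
  have : 0 < q + R ^ 2 := by positivity
  rw [profile, mul_pow, Real.sq_sqrt (by positivity)]
  field_simp

lemma hasDerivAt_profile {R q : ℝ} (hR : 0 < R) (hq : 0 ≤ q) :
    HasDerivAt (profile R) (profile R q * (1 / (q + 1) - 1 / (q + R ^ 2)) / 2) q := by
  have h1 : 0 < q + 1 := by positivity
  have h2 : 0 < q + R ^ 2 := by positivity
  have h3 : 0 < (q + 1) / (q + R ^ 2) := by positivity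
  have h := ((((hasDerivAt_id q).add_const 1).div ((hasDerivAt_id q).add_const (R ^ 2))
    h2.ne').sqrt h3.ne').const_mul R
  refine h.congr_deriv ?_
  simp only [id, Pi.div_apply]
  have hs := Real.sq_sqrt h3.le
  have hs0 := Real.sqrt_pos.2 h3
  rw [profile]
  set s := √((q + 1) / (q + R ^ 2)) with hsdef
  have hs' : s ^ 2 * (q + R ^ 2) = q + 1 := by rw [hs]; field_simp
  field_simp
  linear_combination (-(q + R ^ 2 - (q + 1))) * hs'

lemma contDiffAt_profile {R q : ℝ} (hR : 0 < R) (hq : 0 ≤ q) : ContDiffAt ℝ 1 (profile R) q := by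
  have h2 : 0 < q + R ^ 2 := by positivity
  have h3 : 0 < (q + 1) / (q + R ^ 2) := by positivity
  have h4 : ContDiffAt ℝ 1 (fun z : ℝ => (z + 1) / (z + R ^ 2)) q :=
    ContDiffAt.div (by fun_prop) (by fun_prop) h2.ne'
  exact contDiffAt_const.mul (h4.sqrt h3.ne')

/-- The radial cutoff profile used as a test deformation. -/
def cutProfile (R M q : ℝ) : ℝ :=
  smoothTransition (q - 2) * profile R q * smoothTransition (2 - q / M)

lemma contDiff_cutProfile {R M : ℝ} (hR : 0 < R) : ContDiff ℝ 1 (cutProfile R M) := by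
  rw [contDiff_iff_contDiffAt]
  intro q
  rcases lt_or_ge 0 q with hq | hq
  · unfold cutProfile
    refine ContDiffAt.mul (ContDiffAt.mul ?_ (contDiffAt_profile hR hq.le)) ?_
    · exact (smoothTransition.contDiff.comp (by fun_prop)).contDiffAt
    · exact (smoothTransition.contDiff.comp (by fun_prop)).contDiffAt
  · refine (contDiffAt_const (c := (0 : ℝ))).congr_of_eventuallyEq ?_
    filter_upwards [Iio_mem_nhds (show q < 2 by linarith)] with z hz
    have hz' : z < 2 := hz
    simp [cutProfile, smoothTransition.zero_of_nonpos (show z - 2 ≤ 0 by linarith)]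

lemma cutProfile_eq_zero {R M q : ℝ} (hM : 0 < M) (hq : q ≤ 2 ∨ 2 * M ≤ q) :
    cutProfile R M q = 0 := by
  rcases hq with hq | hq
  · simp [cutProfile, smoothTransition.zero_of_nonpos (show q - 2 ≤ 0 by linarith)]
  · have : 2 ≤ q / M := by rwa [le_div_iff₀ hM]
    simp [cutProfile, smoothTransition.zero_of_nonpos (show 2 - q / M ≤ 0 by linarith)]

lemma deriv_cutProfile {R M q : ℝ} (hR : 0 < R) (hq : 0 ≤ q) :
    deriv (cutProfile R M) q =
      (deriv smoothTransition (q - 2) * profile R q +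
        smoothTransition (q - 2) * (profile R q * (1 / (q + 1) - 1 / (q + R ^ 2)) / 2)) *
        smoothTransition (2 - q / M) -
      smoothTransition (q - 2) * profile R q * (deriv smoothTransition (2 - q / M) / M) := by
  have hS : ∀ x, HasDerivAt smoothTransition (deriv smoothTransition x) x := fun x =>
    ((smoothTransition.contDiff (n := 1)).differentiable (by norm_num) x).hasDerivAt
  have h1 := (hS (q - 2)).comp q ((hasDerivAt_id q).sub_const 2)
  have h2 := (hS (2 - q / M)).comp q (((hasDerivAt_id q).div_const M).const_sub 2)
  refine (((h1.mul (hasDerivAt_profile hR hq)).mul h2).congr_deriv ?_).deriv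
  simp only [Function.comp_apply, id, Pi.mul_apply]
  ring

/-- A step function bounding the first variation of `cutProfile` from below. -/
def lowerStep (R M D q : ℝ) : ℝ :=
  R / 4 * (if R ^ 2 ≤ q then 1 else 0) - 12 * D -
    (4 * D + 1) * R * (if M ≤ q then 1 else 0)

lemma lowerStep_le {R M D q : ℝ} (hR : 2 ≤ R) (hM : R ^ 2 ≤ M)
    (hD : ∀ x, deriv smoothTransition x ≤ D) (hq : 1 < q) :
    lowerStep R M D q ≤ cutProfile R M q - 2 * q * deriv (cutProfile R M) q ∧
      lowerStep R M D q ≤ cutProfile R M q + 2 * q * deriv (cutProfile R M) q := by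
  have hR0 : 0 < R := by linarith
  have hR4 : 4 ≤ R ^ 2 := by nlinarith
  have hM0 : 0 < M := by linarith
  have hW0 := profile_pos hR0 (show 0 ≤ q by linarith)
  have hWsq := profile_sq hR0 (show 0 ≤ q by linarith)
  have hD0 : 0 ≤ D := by simpa [deriv_smoothTransition_of_nonpos le_rfl] using hD 0
  have hS' : ∀ x, 0 ≤ deriv smoothTransition x := fun x => smoothTransition.monotone.deriv_nonneg
  rw [deriv_cutProfile hR0 (by linarith), cutProfile]
  have hz0 : 0 ≤ q / (q + 1) - q / (q + R ^ 2) := by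
    rw [sub_nonneg]; gcongr; linarith
  have hz1 : q / (q + 1) ≤ 1 := by rw [div_le_one (by linarith)]; linarith
  have hz2 : 0 ≤ q / (q + R ^ 2) := by positivity
  have hz3 : R ^ 2 ≤ q → 1 / 2 ≤ q / (q + R ^ 2) := by
    intro h; rw [le_div_iff₀ (by linarith)]; linarith
  have ha0 := smoothTransition.nonneg (q - 2)
  have ha1 := smoothTransition.le_one (q - 2)
  have hb0 := smoothTransition.nonneg (2 - q / M)
  have hb1 := smoothTransition.le_one (2 - q / M)
  have ha'0 := hS' (q - 2)
  have hb'0 := hS' (2 - q / M)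
  have ha'1 := hD (q - 2)
  have hb'1 := hD (2 - q / M)
  have ha3 : 3 ≤ q → smoothTransition (q - 2) = 1 := fun h =>
    smoothTransition.one_of_one_le (by linarith)
  have ha'3 : 3 ≤ q → deriv smoothTransition (q - 2) = 0 := fun h =>
    deriv_smoothTransition_of_one_le (by linarith)
  have hbM : q ≤ M → smoothTransition (2 - q / M) = 1 := fun h =>
    smoothTransition.one_of_one_le (by
      have : q / M ≤ 1 := by rwa [div_le_one hM0]
      linarith)
  have hb'M : q ≤ M → deriv smoothTransition (2 - q / M) = 0 := fun h =>
    deriv_smoothTransition_of_one_le (by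
      have : q / M ≤ 1 := by rwa [div_le_one hM0]
      linarith)
  have hb'2M : 2 * M ≤ q → deriv smoothTransition (2 - q / M) = 0 := fun h =>
    deriv_smoothTransition_of_nonpos (by
      have : 2 ≤ q / M := by rwa [le_div_iff₀ hM0]
      linarith)
  have hqR0 : 0 < q + R ^ 2 := by linarith
  have hWR : profile R q ≤ R := by
    rw [← pow_le_pow_iff_left₀ hW0.le hR0.le two_ne_zero]
    refine le_of_mul_le_mul_right ?_ hqR0
    rw [hWsq]
    gcongr
    linarith
  have hW2 : q ≤ 3 → profile R q ≤ 2 := by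
    intro h
    rw [← pow_le_pow_iff_left₀ hW0.le zero_le_two two_ne_zero]
    refine le_of_mul_le_mul_right ?_ hqR0
    rw [hWsq]
    nlinarith
  have hWlow : R ^ 2 ≤ q → R / 2 ≤ profile R q := by
    intro h
    rw [← pow_le_pow_iff_left₀ (by positivity) hW0.le two_ne_zero]
    refine le_of_mul_le_mul_right ?_ hqR0
    rw [hWsq, show (R / 2) ^ 2 * (q + R ^ 2) = R ^ 2 * ((q + R ^ 2) / 4) by ring]
    gcongr
    linarith
  obtain ⟨z, hz⟩ : ∃ z, z = q / (q + 1) - q / (q + R ^ 2) := ⟨_, rfl⟩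
  have hzle : z ≤ 1 := by linarith
  have hzle2 : R ^ 2 ≤ q → z ≤ 1 / 2 := fun h => by linarith [hz3 h]
  obtain ⟨β, hβ⟩ : ∃ β, β = 2 * q * (deriv smoothTransition (2 - q / M) / M) := ⟨_, rfl⟩
  have hβ0 : 0 ≤ β := by rw [hβ]; positivity
  have hβM : q ≤ M → β = 0 := fun h => by rw [hβ, hb'M h]; simp
  have hβD : β ≤ 4 * D := by
    rcases le_total (2 * M) q with h | h
    · rw [hβ, hb'2M h]; simp [hD0]
    · rw [hβ, ← mul_div_assoc, div_le_iff₀ hM0]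
      nlinarith [mul_le_mul h hb'1 hb'0 (by linarith)]
  obtain ⟨γ, hγ⟩ : ∃ γ, γ = 2 * q * deriv smoothTransition (q - 2) * profile R q := ⟨_, rfl⟩
  have hγ0 : 0 ≤ γ := by rw [hγ]; positivity
  have hγ3 : 3 ≤ q → γ = 0 := fun h => by rw [hγ, ha'3 h]; simp
  have hγD : γ ≤ 12 * D := by
    rcases le_total 3 q with h | h
    · rw [hγ3 h]; positivity
    · calc γ ≤ 2 * 3 * D * 2 := by
            rw [hγ]; have := hW2 h; gcongr
        _ = 12 * D := by ring
  have hp : 2 * q * ((deriv smoothTransition (q - 2) * profile R q +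
        smoothTransition (q - 2) * (profile R q * (1 / (q + 1) - 1 / (q + R ^ 2)) / 2)) *
        smoothTransition (2 - q / M) -
      smoothTransition (q - 2) * profile R q * (deriv smoothTransition (2 - q / M) / M)) =
      γ * smoothTransition (2 - q / M) +
        smoothTransition (q - 2) * profile R q * smoothTransition (2 - q / M) * z -
        smoothTransition (q - 2) * profile R q * β := by
    rw [hγ, hβ, hz]; ring
  rw [hp, lowerStep]
  clear hp hβ hγ
  generalize profile R q = W at *
  generalize smoothTransition (q - 2) = a at *
  generalize smoothTransition (2 - q / M) = b at *
  have hk : 0 ≤ a * W * b := by positivity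
  have hkz : a * W * b * z ≤ a * W * b := mul_le_of_le_one_right hk hzle
  have hkz0 : 0 ≤ a * W * b * z := by rw [← hz] at hz0; positivity
  have hβ' : 0 ≤ a * W * β := by positivity
  have hγb : γ * b ≤ γ := mul_le_of_le_one_right hγ0 hb1
  have hγb0 : 0 ≤ γ * b := by positivity
  have haWβ : a * W * β ≤ 4 * D * R := by
    calc a * W * β ≤ 1 * R * (4 * D) := by gcongr
      _ = 4 * D * R := by ring
  rcases lt_or_ge q M with hqM | hqM
  · have hβz := hβM hqM.le
    rw [hβz, if_neg (not_le.2 hqM)]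
    by_cases hqR : R ^ 2 ≤ q
    · have e1 := ha3 (by linarith)
      have e2 := hbM hqM.le
      have e3 := hγ3 (by linarith)
      have e4 := hzle2 hqR
      have e5 := hWlow hqR
      rw [if_pos hqR, e1, e2, e3]
      rw [← hz] at hz0
      constructor <;> nlinarith
    · rw [if_neg hqR]
      constructor <;> linarith
  · have e3 := hγ3 (by linarith)
    rw [if_pos hqM, if_pos (hM.trans hqM), e3]
    have : 0 ≤ D * R := by positivity
    constructor <;> linarith

lemma measurable_lowerStep (R M D : ℝ) : Measurable (lowerStep R M D) := by
  unfold lowerStep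
  refine Measurable.sub (Measurable.sub (Measurable.const_mul ?_ _) measurable_const)
    (Measurable.const_mul ?_ _)
  · exact Measurable.ite measurableSet_Ici measurable_const measurable_const
  · exact Measurable.ite measurableSet_Ici measurable_const measurable_const

lemma abs_lowerStep_le {R M D : ℝ} (hR : 0 ≤ R) (hD : 0 ≤ D) (q : ℝ) :
    |lowerStep R M D q| ≤ R / 4 + 12 * D + (4 * D + 1) * R := by
  have : 0 ≤ D * R := by positivity
  unfold lowerStep
  rw [abs_le]
  split_ifs <;> constructor <;> nlinarith

/-- Stationarity under radial deformations forces the exterior energy to decay like `1 / R`. -/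
lemma energy_tail_le {n : E3 → E3} (hu : UnitValuedOn n ExtB1)
    (hd : ∀ x ∈ ExtB1, DifferentiableAt ℝ n x) (hfin : eEnergy ExtB1 n < ⊤)
    (hmin : MinimizingOn n ExtB1) :
    ∃ C : ℝ, 0 < C ∧ ∀ R : ℝ, 2 ≤ R →
      ∫ y in {x : E3 | R ≤ ‖x‖}, gradSq n y ≤ C / R := by
  obtain ⟨D, hD⟩ := exists_deriv_smoothTransition_le
  have hD0 : 0 ≤ D := by simpa [deriv_smoothTransition_of_nonpos le_rfl] using hD 0
  have hG := integrableOn_gradSq hfin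
  have hE0 : 0 ≤ ∫ y in ExtB1, gradSq n y := integral_nonneg fun y => gradSq_nonneg n y
  refine ⟨48 * D * (∫ y in ExtB1, gradSq n y) + 1, by positivity, fun R hR => ?_⟩
  have hmeas : ∀ s : ℝ, MeasurableSet {x : E3 | s ≤ ‖x‖} := fun s =>
    (isClosed_le continuous_const continuous_norm).measurableSet
  have hsub : ∀ s : ℝ, 2 ≤ s → {x : E3 | s ≤ ‖x‖} ⊆ ExtB1 := fun s hs x hx =>
    lt_of_lt_of_le (by linarith : (1 : ℝ) < s) hx
  have hind : ∀ s : ℝ, 2 ≤ s → ∫ y in {x : E3 | s ≤ ‖x‖}, gradSq n y =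
      ∫ y in ExtB1, gradSq n y * (if s ^ 2 ≤ ‖y‖ ^ 2 then 1 else 0) := by
    intro s hs
    rw [← Set.inter_eq_right.2 (hsub s hs), ← setIntegral_indicator (hmeas s)]
    refine integral_congr_ae (Eventually.of_forall fun y => ?_)
    have : s ^ 2 ≤ ‖y‖ ^ 2 ↔ s ≤ ‖y‖ :=
      pow_le_pow_iff_left₀ (by linarith) (norm_nonneg y) two_ne_zero
    simp [Set.indicator_apply, this]
  have hintegrable_step : ∀ s : ℝ, IntegrableOn
      (fun y : E3 => gradSq n y * (if s ^ 2 ≤ ‖y‖ ^ 2 then (1 : ℝ) else 0)) ExtB1 := by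
    intro s
    refine hG.mul_bdd (c := 1) (Measurable.aestronglyMeasurable ?_)
      (Eventually.of_forall fun y => ?_)
    · exact Measurable.ite (isClosed_le continuous_const (continuous_norm.pow 2)).measurableSet
        measurable_const measurable_const
    · split_ifs <;> simp
  have hfixed : ∀ s : ℝ, R ≤ s → R / 4 * (∫ y in {x : E3 | R ≤ ‖x‖}, gradSq n y) ≤
      12 * D * (∫ y in ExtB1, gradSq n y) +
        (4 * D + 1) * R * ∫ y in {x : E3 | s ≤ ‖x‖}, gradSq n y := by
    intro s hs
    have hM : R ^ 2 ≤ s ^ 2 := by gcongr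
    have hM0 : 0 < s ^ 2 := by nlinarith
    have key := integral_gradSq_mul_nonpos hu hd hfin hmin (b := 2 * s ^ 2)
      (contDiff_cutProfile (R := R) (M := s ^ 2) (by linarith))
      (fun q hq => cutProfile_eq_zero hM0 hq) (measurable_lowerStep R (s ^ 2) D)
      (abs_lowerStep_le (by linarith) hD0) (fun q hq => (lowerStep_le hR hM hD hq).1)
      (fun q hq => (lowerStep_le hR hM hD hq).2)
    have heq : (fun y : E3 => gradSq n y * lowerStep R (s ^ 2) D (‖y‖ ^ 2)) = fun y =>
        R / 4 * (gradSq n y * (if R ^ 2 ≤ ‖y‖ ^ 2 then 1 else 0)) - 12 * D * gradSq n y -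
          (4 * D + 1) * R * (gradSq n y * (if s ^ 2 ≤ ‖y‖ ^ 2 then 1 else 0)) := by
      ext1 y; unfold lowerStep; ring
    have hdiff : IntegrableOn (fun y : E3 =>
        R / 4 * (gradSq n y * (if R ^ 2 ≤ ‖y‖ ^ 2 then 1 else 0)) - 12 * D * gradSq n y) ExtB1 :=
      ((hintegrable_step R).const_mul _).sub (hG.const_mul _)
    rw [heq, integral_sub hdiff ((hintegrable_step s).const_mul _),
      integral_sub ((hintegrable_step R).const_mul _) (hG.const_mul _), integral_const_mul,
      integral_const_mul, integral_const_mul, ← hind R hR, ← hind s (hR.trans hs)] at key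
    linarith
  have hlim : Tendsto (fun s : ℝ => ∫ y in {x : E3 | s ≤ ‖x‖}, gradSq n y) atTop (𝓝 0) := by
    have h := tendsto_setIntegral_of_antitone (μ := volume) (f := gradSq n)
      (s := fun s : ℝ => {x : E3 | s ≤ ‖x‖}) hmeas
      (fun a b hab x hx => le_trans hab hx) ⟨2, hG.mono_set (hsub 2 le_rfl)⟩
    have hempty : ⋂ s : ℝ, {x : E3 | s ≤ ‖x‖} = ∅ := by
      ext x
      simp only [Set.mem_iInter, Set.mem_ofPred_eq, Set.mem_empty_iff_false, iff_false, not_forall,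
        not_le]
      exact ⟨‖x‖ + 1, by linarith⟩
    rwa [hempty, setIntegral_empty] at h
  have hlim2 := (hlim.const_mul ((4 * D + 1) * R)).const_add (12 * D * ∫ y in ExtB1, gradSq n y)
  rw [mul_zero, add_zero] at hlim2
  have hfin2 := ge_of_tendsto hlim2 ((eventually_ge_atTop R).mono hfixed)
  rw [le_div_iff₀ (by linarith)]
  linarith

/-- **Algebraic decay of the exterior Dirichlet energy (Step 1 of Theorem 1.1):** if `n` is
an exterior minimizing harmonic map with far-field value `n0 ∈ S²`, then for every `α < 2`
there are `R₀ = R₀(n) ≥ 1` and `C = C(n, α) > 0` with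
`∫_{|x|≥R} |∇n|² ≤ C R^{1−α}` for all `R ≥ R₀`. -/
theorem minimizer_energy_decay (n0 : E3) (hn0 : ‖n0‖ = 1) (n : E3 → E3)
    (hn : ExtMinimizer n0 n) (α : ℝ) (hα : α < 2) :
    ∃ R₀ C : ℝ, 1 ≤ R₀ ∧ 0 < C ∧ ∀ R : ℝ, R₀ ≤ R →
      eEnergy {x : E3 | R ≤ ‖x‖} n ≤ ENNReal.ofReal (C * R ^ (1 - α)) := by
  obtain ⟨hu, hd, -, hfin, hmin⟩ := hn
  obtain ⟨C, hC, hbound⟩ := energy_tail_le hu hd hfin hmin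
  refine ⟨2, C, by norm_num, hC, fun R hR => ?_⟩
  have hsub : {x : E3 | R ≤ ‖x‖} ⊆ ExtB1 := fun x hx => lt_of_lt_of_le (by linarith : (1 : ℝ) < R) hx
  rw [eEnergy, ← ofReal_integral_eq_lintegral_ofReal ((integrableOn_gradSq hfin).mono_set hsub)
    (Eventually.of_forall (gradSq_nonneg n))]
  refine ENNReal.ofReal_le_ofReal ((hbound R hR).trans ?_)
  rw [div_eq_mul_inv, ← Real.rpow_neg_one]
  exact mul_le_mul_of_nonneg_left
    (Real.rpow_le_rpow_of_exponent_le (by linarith) (by linarith)) hC.le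

end
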